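/- There exists C > 0 depending only on n and W such that for every sufficiently large R there exist a function g_R : ℝ → [-1,1] and real numbers t_R^- < 0 < t_R^+ with |t_R^±| ≤ C log R such that: (1) g_R is C² and strictly increasing on [t_R^-, t_R^+], g_R is constant on (-∞, t_R^-], and g_R = 1 on [t_R^+, ∞); (2) g_R(0) = 0, g_R'(t_R^-) = 0, and |g - g_R| ≤ C/R together with |g' - g_R'| ≤ C/R on [-4,4]; (3) the inequality g_R'' + (2(n-1)/R) g_R' ≤ W'(g_R) + (C/R)·χ_{[-1,1]} holds pointwise on ℝ∖{t_R^-, t_R^+}, and at the two points t_R^± it holds in the viscosity sense (for every C² function touching g_R from below there). -/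

import Mathlib

open MeasureTheory Metric Set Filter

noncomputable section

/-- `W` is a double-well potential. -/
def DoubleWell (W : ℝ → ℝ) : Prop :=
  ContDiffOn ℝ 2 W (Set.Icc (-1) 1) ∧ W (-1) = 0 ∧ W 1 = 0 ∧
  (∀ s ∈ Set.Ioo (-1:ℝ) 1, 0 < W s) ∧ deriv W (-1) = 0 ∧ deriv W 1 = 0 ∧
  0 < deriv (deriv W) (-1) ∧ 0 < deriv (deriv W) 1

/-- `g` is the one-dimensional solution of `g'' = W'(g)`, `g' > 0`, `g(0)=0`,
`g(±∞) = ±1`. -/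
def IsOneDSolution (W g : ℝ → ℝ) : Prop :=
  ContDiff ℝ 2 g ∧ (∀ t, g t ∈ Set.Ioo (-1:ℝ) 1) ∧
  (∀ t, deriv (deriv g) t = deriv W (g t)) ∧ (∀ t, 0 < deriv g t) ∧ g 0 = 0 ∧
  Tendsto g atTop (nhds 1) ∧ Tendsto g atBot (nhds (-1))

theorem sub_le_sub_of_hasDerivAt_le {f g f' g' : ℝ → ℝ} {a b x y : ℝ}
    (hf : ContinuousOn f (Icc a b)) (hg : ContinuousOn g (Icc a b))
    (hf' : ∀ t ∈ Ioo a b, HasDerivAt f (f' t) t) (hg' : ∀ t ∈ Ioo a b, HasDerivAt g (g' t) t)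
    (hle : ∀ t ∈ Ioo a b, f' t ≤ g' t) (hx : x ∈ Icc a b) (hy : y ∈ Icc a b) (hxy : x ≤ y) :
    f y - f x ≤ g y - g x := by
  have key : MonotoneOn (fun t => g t - f t) (Icc a b) := by
    apply monotoneOn_of_hasDerivWithinAt_nonneg (f' := fun t => g' t - f' t) (convex_Icc a b)
      (hg.sub hf)
    · intro t ht
      rw [interior_Icc] at ht
      exact ((hg' t ht).sub (hf' t ht)).hasDerivWithinAt
    · intro t ht
      rw [interior_Icc] at ht
      exact sub_nonneg.2 (hle t ht)
  have := key hx hy hxy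
  simp only at this
  linarith

theorem hasDerivWithinAt_Icc_of_Ioo {f f' : ℝ → ℝ} {a b : ℝ} (hab : a < b)
    (hf : ContinuousOn f (Icc a b)) (hf' : ContinuousOn f' (Icc a b))
    (hd : ∀ t ∈ Ioo a b, HasDerivAt f (f' t) t) {t : ℝ} (ht : t ∈ Icc a b) :
    HasDerivWithinAt f (f' t) (Icc a b) t := by
  have hderiv : EqOn (deriv f) f' (Ioo a b) := fun s hs => (hd s hs).deriv
  have hdiff : DifferentiableOn ℝ f (Ioo a b) :=
    fun s hs => (hd s hs).differentiableAt.differentiableWithinAt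
  rcases eq_or_lt_of_le ht.1 with rfl | h1
  · refine (hasDerivWithinAt_Ici_of_tendsto_deriv (s := Ioo a b) hdiff
      ((hf a ht).mono Ioo_subset_Icc_self) (Ioo_mem_nhdsGT hab) ?_).mono Icc_subset_Ici_self
    have : Tendsto f' (nhdsWithin a (Ioo a b)) (nhds (f' a)) :=
      (hf' a ht).mono Ioo_subset_Icc_self
    rw [← nhdsWithin_Ioo_eq_nhdsGT hab]
    exact this.congr' (eventually_nhdsWithin_of_forall fun s hs => (hderiv hs).symm)
  rcases eq_or_lt_of_le ht.2 with rfl | h2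
  · refine (hasDerivWithinAt_Iic_of_tendsto_deriv (s := Ioo a t) hdiff
      ((hf t ht).mono Ioo_subset_Icc_self) (Ioo_mem_nhdsLT hab) ?_).mono Icc_subset_Iic_self
    have : Tendsto f' (nhdsWithin t (Ioo a t)) (nhds (f' t)) :=
      (hf' t ht).mono Ioo_subset_Icc_self
    rw [← nhdsWithin_Ioo_eq_nhdsLT hab]
    exact this.congr' (eventually_nhdsWithin_of_forall fun s hs => (hderiv hs).symm)
  exact (hd t ⟨h1, h2⟩).hasDerivWithinAt

theorem exists_primitive_of_le {p F f : ℝ → ℝ} {a b c : ℝ} (hc : c ∈ Ioo a b)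
    (hp : ContinuousOn p (Ioo a b)) (hp0 : ∀ s ∈ Ioo a b, 0 ≤ p s)
    (hF : ContinuousOn F (Icc a b)) (hF' : ∀ s ∈ Ioo a b, HasDerivAt F (f s) s)
    (hpf : ∀ s ∈ Ioo a b, p s ≤ f s) :
    ∃ T : ℝ → ℝ, ContinuousOn T (Icc a b) ∧ (∀ s ∈ Ioo a b, HasDerivAt T (p s) s) ∧ T c = 0 := by
  have hab : a ≤ b := (hc.1.trans hc.2).le
  have hf : IntegrableOn f (Ioo a b) := by
    rw [← integrableOn_Ioc_iff_integrableOn_Ioo]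
    exact intervalIntegral.integrableOn_deriv_of_nonneg hF hF' fun s hs => (hp0 s hs).trans (hpf s hs)
  have hpi : IntegrableOn p (Ioo a b) := by
    refine hf.mono' (hp.aestronglyMeasurable measurableSet_Ioo) ?_
    filter_upwards [ae_restrict_mem measurableSet_Ioo] with s hs
    rw [Real.norm_of_nonneg (hp0 s hs)]
    exact hpf s hs
  have hpI : IntegrableOn p (uIcc a b) := by
    rw [uIcc_of_le hab]
    rwa [integrableOn_Icc_iff_integrableOn_Ioo]
  have hcI : c ∈ uIcc a b := by
    rw [uIcc_of_le hab]; exact Ioo_subset_Icc_self hc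
  refine ⟨fun s => ∫ u in c..s, p u, ?_, ?_, by simp⟩
  · have := intervalIntegral.continuousOn_primitive_interval' (μ := volume) (a := c)
      (hpI.intervalIntegrable) hcI
    rwa [uIcc_of_le hab] at this
  · intro s hs
    refine intervalIntegral.integral_hasDerivAt_right ?_
      (hp.stronglyMeasurableAtFilter isOpen_Ioo s hs) (hp.continuousAt (Ioo_mem_nhds hs.1 hs.2))
    refine (hpI.mono_set ?_).intervalIntegrable
    refine uIcc_subset_uIcc hcI ?_
    rw [uIcc_of_le hab]; exact Ioo_subset_Icc_self hs

theorem deriv_deriv_nonpos_of_le_left {ψ : ℝ → ℝ} {t : ℝ} (hψ : ContDiff ℝ 2 ψ)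
    (hd : deriv ψ t = 0) (hle : ∀ s ≤ t, ψ s ≤ ψ t) : deriv (deriv ψ) t ≤ 0 := by
  by_contra! hpos
  have hmin := isLocalMin_of_deriv_deriv_pos hpos hd hψ.continuous.continuousAt
  have hdd : HasDerivAt (deriv ψ) (deriv (deriv ψ) t) t :=
    ((hψ.differentiable_deriv_two) t).hasDerivAt
  have hdw : HasDerivWithinAt (deriv ψ) (deriv (deriv ψ) t) (Iio t) t := hdd.hasDerivWithinAt
  have h0 : HasDerivWithinAt (deriv ψ) 0 (Iio t) t := by
    refine (hasDerivWithinAt_const t (Iio t) (0 : ℝ)).congr_of_eventuallyEq ?_ hd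
    have hev : ∀ᶠ s in nhds t, s < t → ψ s = ψ t := by
      filter_upwards [hmin] with s hs hst using le_antisymm (hle s hst.le) hs
    filter_upwards [nhdsWithin_le_nhds hev.eventually_nhds, self_mem_nhdsWithin] with s hs hst
    have : ψ =ᶠ[nhds s] fun _ => ψ t := by
      filter_upwards [hs, Iio_mem_nhds hst] with r hr hrt using hr hrt
    rw [this.deriv_eq, deriv_const]
  have := (uniqueDiffWithinAt_Iio t).eq_deriv _ hdw h0
  linarith

/-- `T` is the time function of the first order equation `G' = √(2 H(G))` on the range `[a, 1]`,
normalised by `T 0 = 0`, and `G` is its inverse, extended by constants. -/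
structure IsProfile (H : ℝ → ℝ) (a M : ℝ) (T G : ℝ → ℝ) : Prop where
  continuousOn_time : ContinuousOn T (Icc a 1)
  hasDerivAt_time : ∀ s ∈ Ioo a 1, HasDerivAt T (√(2 * H s))⁻¹ s
  time_zero : T 0 = 0
  strictMonoOn_time : StrictMonoOn T (Icc a 1)
  mem : ∀ t, G t ∈ Icc a 1
  apply_time : ∀ s ∈ Icc a 1, G (T s) = s
  time_apply : ∀ t ∈ Icc (T a) (T 1), T (G t) = t
  apply_of_le : ∀ t ≤ T a, G t = a
  apply_of_ge : ∀ t, T 1 ≤ t → G t = 1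
  lipschitz : ∀ t t', |G t - G t'| ≤ M * |t - t'|

theorem exists_isProfile {H F f : ℝ → ℝ} {a M : ℝ} (ha : a < 0)
    (hH : ContinuousOn H (Icc a 1)) (hpos : ∀ s ∈ Ioo a 1, 0 < H s)
    (hM : ∀ s ∈ Ioo a 1, √(2 * H s) ≤ M)
    (hF : ContinuousOn F (Icc a 1)) (hF' : ∀ s ∈ Ioo a 1, HasDerivAt F (f s) s)
    (hf : ∀ s ∈ Ioo a 1, (√(2 * H s))⁻¹ ≤ f s) :
    ∃ T G : ℝ → ℝ, IsProfile H a M T G ∧ T 1 - T a ≤ F 1 - F a := by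
  have hsq : ∀ s ∈ Ioo a 1, 0 < √(2 * H s) := fun s hs =>
    Real.sqrt_pos.2 (mul_pos two_pos (hpos s hs))
  have h0 : (0 : ℝ) ∈ Ioo a 1 := ⟨ha, one_pos⟩
  have ha1 : a ≤ 1 := ha.le.trans zero_le_one
  have hM0 : 0 ≤ M := (Real.sqrt_nonneg _).trans (hM 0 h0)
  obtain ⟨T, hT, hT', hT0⟩ := exists_primitive_of_le (p := fun s => (√(2 * H s))⁻¹) h0
    (ContinuousOn.inv₀ ((continuousOn_const.mul (hH.mono Ioo_subset_Icc_self)).sqrt)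
      fun s hs => (hsq s hs).ne') (fun s hs => (inv_pos.2 (hsq s hs)).le) hF hF' hf
  have hmono : StrictMonoOn T (Icc a 1) := by
    refine strictMonoOn_of_hasDerivWithinAt_pos (f' := fun s => (√(2 * H s))⁻¹)
      (convex_Icc a 1) hT ?_ ?_
    · intro s hs
      rw [interior_Icc] at hs
      exact (hT' s hs).hasDerivWithinAt
    · intro s hs
      rw [interior_Icc] at hs
      exact inv_pos.2 (hsq s hs)
  have hexp : ∀ s ∈ Icc a 1, ∀ s' ∈ Icc a 1, s ≤ s' → s' - s ≤ M * T s' - M * T s := by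
    intro s hs s' hs' hss
    refine sub_le_sub_of_hasDerivAt_le (f := fun s => s) (f' := fun _ => 1)
      (g := fun s => M * T s) (g' := fun s => M * (√(2 * H s))⁻¹) continuousOn_id
      (continuousOn_const.mul hT) (fun s _ => hasDerivAt_id s)
      (fun s hs => (hT' s hs).const_mul M) ?_ hs hs' hss
    intro t ht
    rw [← div_eq_mul_inv, one_le_div (hsq t ht)]
    exact hM t ht
  have hexp' : ∀ s ∈ Icc a 1, ∀ s' ∈ Icc a 1, |s - s'| ≤ M * |T s - T s'| := by
    intro s hs s' hs'
    rcases le_total s s' with h | h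
    · rw [abs_sub_comm, abs_of_nonneg (sub_nonneg.2 h), abs_sub_comm,
        abs_of_nonneg (sub_nonneg.2 (hmono.monotoneOn hs hs' h))]
      linarith [hexp s hs s' hs' h]
    · rw [abs_of_nonneg (sub_nonneg.2 h),
        abs_of_nonneg (sub_nonneg.2 (hmono.monotoneOn hs' hs h))]
      linarith [hexp s' hs' s hs h]
  have haI : a ∈ Icc a 1 := left_mem_Icc.2 ha1
  have h1I : (1 : ℝ) ∈ Icc a 1 := right_mem_Icc.2 ha1
  have hTa : T a ≤ T 1 := hmono.monotoneOn haI h1I ha1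
  have hex : ∀ t, ∃ s ∈ Icc a 1, T s = max (T a) (min (T 1) t) := fun t =>
    intermediate_value_Icc ha1 hT ⟨le_max_left _ _, max_le hTa (min_le_left _ _)⟩
  choose G hG hTG using hex
  have hTG' : ∀ t ∈ Icc (T a) (T 1), T (G t) = t := fun t ht => by
    rw [hTG, min_eq_right ht.2, max_eq_right ht.1]
  refine ⟨T, G, ⟨hT, hT', hT0, hmono, hG, ?_, hTG', ?_, ?_, ?_⟩, ?_⟩
  · intro s hs
    refine hmono.injOn (hG _) hs (hTG' _ ⟨hmono.monotoneOn haI hs hs.1, hmono.monotoneOn hs h1I hs.2⟩)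
  · intro t ht
    refine hmono.injOn (hG _) haI ?_
    rw [hTG, max_eq_left ((min_le_right _ _).trans ht)]
  · intro t ht
    refine hmono.injOn (hG _) h1I ?_
    rw [hTG, min_eq_left ht, max_eq_right hTa]
  · intro t t'
    refine (hexp' _ (hG t) _ (hG t')).trans (mul_le_mul_of_nonneg_left ?_ hM0)
    rw [hTG, hTG, max_comm, max_comm (T a), min_comm, min_comm (T 1)]
    refine (abs_max_sub_max_le_abs _ _ _).trans ((abs_min_sub_min_le_max _ _ _ _).trans ?_)
    simp
  · exact sub_le_sub_of_hasDerivAt_le hT hF hT' hF' hf haI h1I ha1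

namespace IsProfile

variable {H h T G : ℝ → ℝ} {a M : ℝ}

theorem continuous (hP : IsProfile H a M T G) : Continuous G := by
  have hM : 0 ≤ M := by
    have h1 := hP.lipschitz 1 0
    rw [sub_zero, abs_one, mul_one] at h1
    exact (abs_nonneg _).trans h1
  refine (LipschitzWith.of_dist_le_mul (K := ⟨M, hM⟩) fun x y => ?_).continuous
  exact hP.lipschitz x y

theorem time_left_lt (hP : IsProfile H a M T G) (ha : a < 0) : T a < 0 := by
  rw [← hP.time_zero]
  exact hP.strictMonoOn_time ⟨le_rfl, by linarith⟩ ⟨ha.le, zero_le_one⟩ ha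

theorem time_right_gt (hP : IsProfile H a M T G) (ha : a < 0) : 0 < T 1 := by
  rw [← hP.time_zero]
  exact hP.strictMonoOn_time ⟨ha.le, zero_le_one⟩ ⟨by linarith, le_rfl⟩ one_pos

theorem strictMonoOn (hP : IsProfile H a M T G) : StrictMonoOn G (Icc (T a) (T 1)) := by
  intro t ht t' ht' htt
  rw [← hP.strictMonoOn_time.lt_iff_lt (hP.mem t) (hP.mem t'), hP.time_apply t ht,
    hP.time_apply t' ht']
  exact htt

theorem apply_mem_Ioo (hP : IsProfile H a M T G) {t : ℝ} (ht : t ∈ Ioo (T a) (T 1)) :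
    G t ∈ Ioo a 1 := by
  have hlt : T a ≤ T 1 := (ht.1.trans ht.2).le
  have h1 := hP.strictMonoOn (left_mem_Icc.2 hlt) (Ioo_subset_Icc_self ht) ht.1
  have h2 := hP.strictMonoOn (Ioo_subset_Icc_self ht) (right_mem_Icc.2 hlt) ht.2
  rw [hP.apply_of_le _ le_rfl] at h1
  rw [hP.apply_of_ge _ le_rfl] at h2
  exact ⟨h1, h2⟩

theorem hasDerivAt (hP : IsProfile H a M T G) (hpos : ∀ s ∈ Ioo a 1, 0 < H s)
    {t : ℝ} (ht : t ∈ Ioo (T a) (T 1)) : HasDerivAt G (√(2 * H (G t))) t := by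
  have hG := hP.apply_mem_Ioo ht
  have hsq : 0 < √(2 * H (G t)) := Real.sqrt_pos.2 (mul_pos two_pos (hpos _ hG))
  have := HasDerivAt.of_local_left_inverse (hP.continuous.continuousAt (x := t))
    (hP.hasDerivAt_time _ hG) (inv_pos.2 hsq).ne' ?_
  · rwa [inv_inv] at this
  · filter_upwards [Ioo_mem_nhds ht.1 ht.2] with s hs
    exact hP.time_apply s (Ioo_subset_Icc_self hs)

theorem hasDerivAt_sqrt (hP : IsProfile H a M T G) (hpos : ∀ s ∈ Ioo a 1, 0 < H s)
    (hH' : ∀ s ∈ Ioo a 1, HasDerivAt H (h s) s)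
    {t : ℝ} (ht : t ∈ Ioo (T a) (T 1)) :
    HasDerivAt (fun t => √(2 * H (G t))) (h (G t)) t := by
  have hG := hP.apply_mem_Ioo ht
  have h2 : 0 < 2 * H (G t) := mul_pos two_pos (hpos _ hG)
  have hsq : 0 < √(2 * H (G t)) := Real.sqrt_pos.2 h2
  have h1 := (((hH' _ hG).comp t (hP.hasDerivAt hpos ht)).const_mul 2).sqrt h2.ne'
  exact h1.congr_deriv (show 2 * (h (G t) * √(2 * H (G t))) / (2 * √(2 * H (G t))) = h (G t) by
    field_simp)

theorem deriv_deriv (hP : IsProfile H a M T G) (hpos : ∀ s ∈ Ioo a 1, 0 < H s)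
    (hH' : ∀ s ∈ Ioo a 1, HasDerivAt H (h s) s)
    {t : ℝ} (ht : t ∈ Ioo (T a) (T 1)) : deriv (deriv G) t = h (G t) := by
  refine ((hP.hasDerivAt_sqrt hpos hH' ht).congr_of_eventuallyEq ?_).deriv
  filter_upwards [Ioo_mem_nhds ht.1 ht.2] with s hs
  exact (hP.hasDerivAt hpos hs).deriv

theorem continuous_sqrt (hP : IsProfile H a M T G) (hH : ContinuousOn H (Icc a 1)) :
    Continuous fun t => √(2 * H (G t)) :=
  (continuous_const.mul (hH.comp_continuous hP.continuous hP.mem)).sqrt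

theorem hasDerivWithinAt (hP : IsProfile H a M T G) (ha : a < 0)
    (hH : ContinuousOn H (Icc a 1)) (hpos : ∀ s ∈ Ioo a 1, 0 < H s)
    {t : ℝ} (ht : t ∈ Icc (T a) (T 1)) :
    HasDerivWithinAt G (√(2 * H (G t))) (Icc (T a) (T 1)) t :=
  hasDerivWithinAt_Icc_of_Ioo (f' := fun t => √(2 * H (G t)))
    ((hP.time_left_lt ha).trans (hP.time_right_gt ha))
    hP.continuous.continuousOn (hP.continuous_sqrt hH).continuousOn
    (fun _ hs => hP.hasDerivAt hpos hs) ht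

theorem contDiffOn (hP : IsProfile H a M T G) (ha : a < 0)
    (hH : ContinuousOn H (Icc a 1)) (hpos : ∀ s ∈ Ioo a 1, 0 < H s)
    (hh : ContinuousOn h (Icc a 1)) (hH' : ∀ s ∈ Ioo a 1, HasDerivAt H (h s) s) :
    ContDiffOn ℝ 2 G (Icc (T a) (T 1)) := by
  have hlt : T a < T 1 := (hP.time_left_lt ha).trans (hP.time_right_gt ha)
  have hu := uniqueDiffOn_Icc hlt
  have h1 : ∀ t ∈ Icc (T a) (T 1), HasDerivWithinAt G (√(2 * H (G t))) (Icc (T a) (T 1)) t :=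
    fun t ht => hP.hasDerivWithinAt ha hH hpos ht
  have hhG : Continuous fun t => h (G t) := hh.comp_continuous hP.continuous hP.mem
  have h2 : ∀ t ∈ Icc (T a) (T 1), HasDerivWithinAt (fun t => √(2 * H (G t))) (h (G t))
      (Icc (T a) (T 1)) t := fun t ht =>
    hasDerivWithinAt_Icc_of_Ioo (f' := fun t => h (G t)) hlt
      (hP.continuous_sqrt hH).continuousOn hhG.continuousOn
      (fun _ hs => hP.hasDerivAt_sqrt hpos hH' hs) ht
  rw [show (2 : WithTop ℕ∞) = 1 + 1 by norm_num, contDiffOn_succ_iff_derivWithin hu]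
  refine ⟨fun t ht => (h1 t ht).differentiableWithinAt, by simp, ?_⟩
  refine ContDiffOn.congr (f := fun t => √(2 * H (G t))) ?_
    fun t ht => (h1 t ht).derivWithin (hu t ht)
  rw [contDiffOn_one_iff_derivWithin hu]
  exact ⟨fun t ht => (h2 t ht).differentiableWithinAt,
    hhG.continuousOn.congr fun t ht => (h2 t ht).derivWithin (hu t ht)⟩

theorem hasDerivAt_left (hP : IsProfile H a M T G) (ha : a < 0)
    (hH : ContinuousOn H (Icc a 1)) (hpos : ∀ s ∈ Ioo a 1, 0 < H s) (hHa : H a = 0) :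
    HasDerivAt G 0 (T a) := by
  have hlt : T a < T 1 := (hP.time_left_lt ha).trans (hP.time_right_gt ha)
  have h1 := hP.hasDerivWithinAt ha hH hpos (left_mem_Icc.2 hlt.le)
  rw [hP.apply_of_le _ le_rfl, hHa, mul_zero, Real.sqrt_zero] at h1
  have h2 : HasDerivWithinAt G 0 (Iic (T a)) (T a) :=
    (hasDerivWithinAt_const (T a) (Iic (T a)) a).congr
      (fun t ht => hP.apply_of_le t ht) (hP.apply_of_le _ le_rfl)
  refine (h2.union h1).hasDerivAt ?_
  rw [Iic_union_Icc_eq_Iic hlt.le]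
  exact Iic_mem_nhds hlt

theorem viscosity_left (hP : IsProfile H a M T G) (ha : a < 0)
    (hH : ContinuousOn H (Icc a 1)) (hpos : ∀ s ∈ Ioo a 1, 0 < H s) (hHa : H a = 0)
    {ψ : ℝ → ℝ} (hψ : ContDiff ℝ 2 ψ) (heq : ψ (T a) = G (T a)) (hle : ∀ s, ψ s ≤ G s) :
    deriv ψ (T a) = 0 ∧ deriv (deriv ψ) (T a) ≤ 0 := by
  have hd : deriv ψ (T a) = 0 := by
    have h1 := (hP.hasDerivAt_left ha hH hpos hHa).sub
      ((hψ.differentiable two_ne_zero) (T a)).hasDerivAt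
    have h2 : IsLocalMin (G - ψ) (T a) := Eventually.of_forall fun s => by
      simp only [Pi.sub_apply, heq, sub_self]
      linarith [hle s]
    have := h2.hasDerivAt_eq_zero h1
    linarith
  refine ⟨hd, deriv_deriv_nonpos_of_le_left hψ hd fun s hs => ?_⟩
  rw [heq, hP.apply_of_le _ le_rfl, ← hP.apply_of_le s hs]
  exact hle s

theorem not_touching_right (hP : IsProfile H a M T G) (ha : a < 0)
    (hH : ContinuousOn H (Icc a 1)) (hpos : ∀ s ∈ Ioo a 1, 0 < H s) (hH1 : 0 < H 1)
    {ψ : ℝ → ℝ} (hψ : ContDiff ℝ 2 ψ) (heq : ψ (T 1) = G (T 1)) : ¬ ∀ s, ψ s ≤ G s := by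
  intro hle
  have hlt : T a < T 1 := (hP.time_left_lt ha).trans (hP.time_right_gt ha)
  have hG1 : G (T 1) = 1 := hP.apply_of_ge _ le_rfl
  have hψd := ((hψ.differentiable two_ne_zero) (T 1)).hasDerivAt
  have hd : deriv ψ (T 1) = 0 := by
    have h2 : IsLocalMax ψ (T 1) := Eventually.of_forall fun s => by
      rw [heq, hG1]
      exact (hle s).trans (hP.mem s).2
    exact h2.hasDerivAt_eq_zero hψd
  rw [hd] at hψd
  have h1 := ((hP.hasDerivWithinAt ha hH hpos (right_mem_Icc.2 hlt.le)).sub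
    hψd.hasDerivWithinAt).mono Ioo_subset_Icc_self
  rw [hG1, sub_zero, hasDerivWithinAt_iff_tendsto_slope' (by simp),
    nhdsWithin_Ioo_eq_nhdsLT hlt] at h1
  have h3 : √(2 * H 1) ≤ 0 := by
    refine le_of_tendsto h1 ?_
    filter_upwards [self_mem_nhdsWithin] with s hs
    rw [slope_def_field]
    refine div_nonpos_of_nonneg_of_nonpos ?_ (sub_nonpos.2 (le_of_lt hs))
    simp only [Pi.sub_apply, heq, sub_self, sub_zero]
    linarith [hle s]
  have : 0 < √(2 * H 1) := Real.sqrt_pos.2 (mul_pos two_pos hH1)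
  linarith

end IsProfile

namespace DoubleWell

variable {W : ℝ → ℝ}

theorem continuousOn (hW : DoubleWell W) : ContinuousOn W (Icc (-1) 1) := hW.1.continuousOn

theorem hasDerivAt (hW : DoubleWell W) {s : ℝ} (hs : s ∈ Ioo (-1 : ℝ) 1) :
    HasDerivAt W (deriv W s) s :=
  ((hW.1.differentiableOn two_ne_zero s (Ioo_subset_Icc_self hs)).differentiableAt
    (Icc_mem_nhds hs.1 hs.2)).hasDerivAt

theorem continuousOn_deriv (hW : DoubleWell W) : ContinuousOn (deriv W) (Icc (-1) 1) := by
  obtain ⟨h2, -, -, -, -, -, hl, hr⟩ := hW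
  have hopen : ContinuousOn (deriv W) (Ioo (-1) 1) :=
    (h2.mono Ioo_subset_Icc_self).continuousOn_deriv_of_isOpen isOpen_Ioo one_le_two
  intro s hs
  rcases eq_or_lt_of_le hs.1 with rfl | h1
  · exact (differentiableAt_of_deriv_ne_zero hl.ne').continuousAt.continuousWithinAt
  rcases eq_or_lt_of_le hs.2 with rfl | h2
  · exact (differentiableAt_of_deriv_ne_zero hr.ne').continuousAt.continuousWithinAt
  exact (hopen.continuousAt (Ioo_mem_nhds h1 h2)).continuousWithinAt

end DoubleWell

theorem exists_abs_sub_deriv_mul_le {w : ℝ → ℝ} {x : ℝ} (hx : w x = 0) (hd : 0 < deriv w x) :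
    ∃ d > 0, ∀ s, |s - x| ≤ d → |w s - deriv w x * (s - x)| ≤ deriv w x / 2 * |s - x| := by
  have h := (differentiableAt_of_deriv_ne_zero hd.ne').hasDerivAt
  rw [hasDerivAt_iff_isLittleO] at h
  obtain ⟨d, hd0, hd⟩ := Metric.eventually_nhds_iff.1 (h.bound (half_pos hd))
  refine ⟨d / 2, half_pos hd0, fun s hs => ?_⟩
  have := hd (y := s) (by rw [Real.dist_eq]; linarith)
  simpa [hx, mul_comm] using this

theorem DoubleWell.exists_quadratic_bounds {W : ℝ → ℝ} (hW : DoubleWell W) {d₁ : ℝ}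
    (hd₁ : 0 < d₁) (hd₁' : d₁ ≤ 1 / 2) :
    ∃ c C d : ℝ, 0 < c ∧ 0 < C ∧ 0 < d ∧ d ≤ d₁ ∧
      (∀ s ∈ Icc (-1) (-1 + d), 0 ≤ deriv W s) ∧
      (∀ a s, -1 ≤ a → a ≤ s → s ≤ -1 + d → c * ((s + 1) ^ 2 - (a + 1) ^ 2) ≤ W s - W a) ∧
      (∀ s ∈ Icc (-1) (-1 + d), W s ≤ C * (s + 1) ^ 2) ∧
      (∀ s ∈ Icc (1 - d) 1, c * (1 - s) ^ 2 ≤ W s) := by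
  have hWc := hW.continuousOn
  have hWd := fun s hs => hW.hasDerivAt (s := s) hs
  obtain ⟨-, hl0, hr0, -, hl1, hr1, hl2, hr2⟩ := hW
  obtain ⟨dl, hdl, hl⟩ := exists_abs_sub_deriv_mul_le hl1 hl2
  obtain ⟨dr, hdr, hr⟩ := exists_abs_sub_deriv_mul_le hr1 hr2
  set A := deriv (deriv W) (-1) with hA
  set B := deriv (deriv W) 1 with hB
  set d := min d₁ (min dl dr) with hd
  have hd0 : 0 < d := lt_min hd₁ (lt_min hdl hdr)
  have hdd₁ : d ≤ d₁ := min_le_left _ _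
  have hddl : d ≤ dl := (min_le_right _ _).trans (min_le_left _ _)
  have hddr : d ≤ dr := (min_le_right _ _).trans (min_le_right _ _)
  have hl' : ∀ s ∈ Icc (-1) (-1 + d),
      A / 2 * (s + 1) ≤ deriv W s ∧ deriv W s ≤ 3 * A / 2 * (s + 1) := by
    intro s hs
    have h0 : 0 ≤ s - -1 := by linarith [hs.1]
    have := hl s (by rw [abs_of_nonneg h0]; linarith [hs.2])
    rw [abs_of_nonneg h0, abs_le] at this
    constructor <;> linarith [this.1, this.2]
  have hr' : ∀ s ∈ Icc (1 - d) 1, deriv W s ≤ - (B / 2 * (1 - s)) := by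
    intro s hs
    have h0 : s - 1 ≤ 0 := by linarith [hs.2]
    have := hr s (by rw [abs_of_nonpos h0]; linarith [hs.1])
    rw [abs_of_nonpos h0, abs_le] at this
    linarith [this.1, this.2]
  set c := min (A / 4) (B / 4) with hc
  have hc0 : 0 < c := lt_min (by positivity) (by positivity)
  have hcA : c ≤ A / 4 := min_le_left _ _
  have hcB : c ≤ B / 4 := min_le_right _ _
  have hWl : ContinuousOn W (Icc (-1) (-1 + d)) := hWc.mono (Icc_subset_Icc_right (by linarith))
  have hWl' : ∀ t ∈ Ioo (-1) (-1 + d), HasDerivAt W (deriv W t) t := fun t ht =>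
    hWd t ⟨ht.1, by linarith [ht.2]⟩
  refine ⟨c, 3 * A / 4, d, hc0, by positivity, hd0, hdd₁, ?_, ?_, ?_, ?_⟩
  · intro s hs
    refine le_trans ?_ (hl' s hs).1
    have := hs.1
    exact mul_nonneg (by positivity) (by linarith)
  · intro a s ha has hs
    have := sub_le_sub_of_hasDerivAt_le (f := fun s => c * (s + 1) ^ 2)
      (f' := fun s => c * (2 * (s + 1))) (by fun_prop) hWl
      (fun t _ => by simpa using (((hasDerivAt_id t).add_const 1).pow 2).const_mul c)
      hWl' ?_ (x := a) (y := s) ⟨ha, by linarith⟩ ⟨by linarith, hs⟩ has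
    · linarith
    · intro t ht
      refine le_trans ?_ (hl' t (Ioo_subset_Icc_self ht)).1
      nlinarith [ht.1]
  · intro s hs
    have := sub_le_sub_of_hasDerivAt_le (g := fun s => 3 * A / 4 * (s + 1) ^ 2)
      (g' := fun s => 3 * A / 4 * (2 * (s + 1))) hWl (by fun_prop) hWl'
      (fun t _ => by simpa using (((hasDerivAt_id t).add_const 1).pow 2).const_mul (3 * A / 4))
      ?_ (x := -1) (y := s) ⟨le_rfl, by linarith⟩ hs hs.1
    · rw [hl0] at this
      linarith
    · intro t ht
      refine (hl' t (Ioo_subset_Icc_self ht)).2.trans (le_of_eq (by ring))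
  · intro s hs
    have := sub_le_sub_of_hasDerivAt_le (g := fun s => c * (1 - s) ^ 2)
      (g' := fun s => - (c * (2 * (1 - s)))) (a := 1 - d) (b := 1)
      (hWc.mono (Icc_subset_Icc_left (by linarith))) (by fun_prop)
      (fun t ht => hWd t ⟨by linarith [ht.1], ht.2⟩)
      (fun t _ => ((((hasDerivAt_id' t).const_sub 1).pow 2).const_mul c).congr_deriv
        (by norm_num))
      ?_ (x := s) (y := 1) hs ⟨by linarith, le_rfl⟩ hs.2
    · norm_num [hr0] at this
      linarith
    · intro t ht
      refine (hr' t (Ioo_subset_Icc_self ht)).trans ?_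
      have h1 := ht.2
      have := mul_le_mul_of_nonneg_right hcB (by linarith : 0 ≤ 2 * (1 - t))
      linarith

theorem exists_smooth_step {δ : ℝ} (hδ : 0 < δ) :
    ∃ (θ θ' : ℝ → ℝ) (K : ℝ), 0 ≤ K ∧ (∀ s, HasDerivAt θ (θ' s) s) ∧ Continuous θ' ∧
      (∀ s ≤ -δ, θ s = 0) ∧ (∀ s, δ ≤ s → θ s = 1) ∧ (∀ s, 0 ≤ θ s) ∧ (∀ s, θ s ≤ 1) ∧
      (∀ s, s ∉ Icc (-δ) δ → θ' s = 0) ∧ ∀ s, θ' s ≤ K := by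
  set θ : ℝ → ℝ := fun s => Real.smoothTransition ((s + δ) / (2 * δ)) with hθ
  have hsm : ContDiff ℝ 1 θ := Real.smoothTransition.contDiff.comp (by fun_prop)
  have hc : Continuous (deriv θ) := hsm.continuous_deriv le_rfl
  have h0 : ∀ s ≤ -δ, θ s = 0 := fun s hs =>
    Real.smoothTransition.zero_of_nonpos (div_nonpos_of_nonpos_of_nonneg (by linarith) (by linarith))
  have h1 : ∀ s, δ ≤ s → θ s = 1 := fun s hs =>
    Real.smoothTransition.one_of_one_le ((one_le_div (by linarith)).2 (by linarith))
  have hout : ∀ s, s ∉ Icc (-δ) δ → deriv θ s = 0 := by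
    intro s hs
    rcases lt_or_ge s (-δ) with h | h
    · have : θ =ᶠ[nhds s] fun _ => 0 := by
        filter_upwards [Iio_mem_nhds h] with r hr using h0 r (le_of_lt hr)
      rw [this.deriv_eq, deriv_const]
    · have h' : δ < s := lt_of_not_ge fun h' => hs ⟨h, h'⟩
      have : θ =ᶠ[nhds s] fun _ => 1 := by
        filter_upwards [Ioi_mem_nhds h'] with r hr using h1 r (le_of_lt hr)
      rw [this.deriv_eq, deriv_const]
  obtain ⟨K, hK⟩ := (isCompact_Icc (a := -δ) (b := δ)).exists_bound_of_continuousOn hc.continuousOn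
  refine ⟨θ, deriv θ, max K 0, le_max_right _ _,
    fun s => (hsm.differentiable one_ne_zero s).hasDerivAt, hc, h0, h1,
    fun s => Real.smoothTransition.nonneg _, fun s => Real.smoothTransition.le_one _, hout,
    fun s => ?_⟩
  by_cases hs : s ∈ Icc (-δ) δ
  · exact ((le_abs_self _).trans (hK s hs)).trans (le_max_left _ _)
  · rw [hout s hs]
    exact le_max_right _ _

/-- `H` is a perturbation of `W` of size `O(σ²)`, with derivative `h`, that vanishes at `-1 + σ`, is
positive at `1`, and whose profile is a strict subsolution away from the layer `[-δ, δ]`. -/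
structure IsBarrierPotential (W : ℝ → ℝ) (c C M δ Λ σ : ℝ) (H h : ℝ → ℝ) : Prop where
  continuousOn : ContinuousOn H (Icc (-1 + σ) 1)
  continuousOn_deriv : ContinuousOn h (Icc (-1 + σ) 1)
  hasDerivAt : ∀ s ∈ Ioo (-1 + σ) 1, HasDerivAt H (h s) s
  apply_left : H (-1 + σ) = 0
  abs_sub_le : ∀ s ∈ Icc (-1 + σ) 1, |H s - W s| ≤ C * σ ^ 2
  sqrt_le : ∀ s ∈ Icc (-1 + σ) 1, √(2 * H s) ≤ M
  lower_bound : ∀ s ∈ Icc (-1 + σ) 1,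
    c * ((s - (-1 + σ)) * (s - (-1 + σ) + σ)) ≤ H s ∨ c * ((1 - s) ^ 2 + σ ^ 2) ≤ H s
  drift_le_of_notMem : ∀ s ∈ Icc (-1 + σ) 1, s ∉ Icc (-δ) δ →
    h s + Λ * σ ^ 2 * √(2 * H s) ≤ deriv W s
  drift_le : ∀ s ∈ Icc (-1 + σ) 1, h s + Λ * σ ^ 2 * √(2 * H s) ≤ deriv W s + C * σ ^ 2

theorem DoubleWell.exists_isBarrierPotential {W : ℝ → ℝ} (hW : DoubleWell W) {Λ d₁ : ℝ}
    (hΛ : 0 ≤ Λ) (hd₁ : 0 < d₁) (hd₁' : d₁ ≤ 1 / 2) :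
    ∃ c C M δ m d σ₀ : ℝ, 0 < c ∧ 0 < C ∧ 0 < M ∧ 0 < δ ∧ δ ≤ 1 / 2 ∧ δ ^ 2 ≤ m ∧ 0 < d ∧ d ≤ d₁ ∧
      0 < σ₀ ∧ (∀ s ∈ Icc (-1 + d) (1 - d), m ≤ W s) ∧
      (∀ s ∈ Icc (-1) (-1 + d), 0 ≤ deriv W s) ∧
      ∀ σ, 0 < σ → σ < σ₀ → σ < d ∧ C * σ ^ 2 ≤ m / 2 ∧
        ∃ H h : ℝ → ℝ, IsBarrierPotential W c C M δ Λ σ H h := by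
  obtain ⟨c₀, C₀, d, hc₀, hC₀, hd0, hdd₁, hWd0, hWl, hWu, hWr⟩ :=
    hW.exists_quadratic_bounds hd₁ hd₁'
  obtain ⟨s₀, hs₀, hmin⟩ := (isCompact_Icc (a := -1 + d) (b := 1 - d)).exists_isMinOn
    ⟨0, by constructor <;> linarith⟩
    (hW.continuousOn.mono (Icc_subset_Icc (by linarith) (by linarith)))
  obtain ⟨M₀, hM₀⟩ := (isCompact_Icc (a := (-1 : ℝ)) (b := 1)).exists_bound_of_continuousOn
    hW.continuousOn
  have hM₀0 : 0 ≤ M₀ := (norm_nonneg _).trans (hM₀ 0 (by norm_num))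
  set m := W s₀ with hm
  have hm0 : 0 < m := hW.2.2.2.1 s₀ ⟨by linarith [hs₀.1], by linarith [hs₀.2]⟩
  set δ := min (1 / 2) (√m) with hδ
  have hδ0 : 0 < δ := lt_min (by norm_num) (Real.sqrt_pos.2 hm0)
  have hδ2 : δ ≤ 1 / 2 := min_le_left _ _
  have hδm : δ ^ 2 ≤ m := by
    rw [← Real.sq_sqrt hm0.le]
    exact pow_le_pow_left₀ hδ0.le (min_le_right _ _) 2
  obtain ⟨θ, θ', K, hK, hθ, hθ'c, hθ0, hθ1, hθn, hθl, hθ'0, hθ'K⟩ := exists_smooth_step hδ0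
  set M := √(2 * (M₀ + 1)) with hM
  have hM0 : 0 < M := Real.sqrt_pos.2 (by linarith)
  set L := Λ * M with hL
  have hL0 : 0 ≤ L := mul_nonneg hΛ hM0.le
  set D₀ := C₀ + 1 + 2 * L with hD₀
  have hD₀0 : 0 < D₀ := by positivity
  set C := max (C₀ + 2 * L + D₀) (D₀ * K) with hC
  have hC1 : C₀ + 2 * L + D₀ ≤ C := le_max_left _ _
  have hC2 : D₀ * K ≤ C := le_max_right _ _
  have hC0 : 0 < C := lt_of_lt_of_le (by positivity) hC1
  set c := min (min c₀ 1) (m / 12) with hc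
  have hc0 : 0 < c := lt_min (lt_min hc₀ one_pos) (by positivity)
  have hcc : c ≤ c₀ := (min_le_left _ _).trans (min_le_left _ _)
  have hc1 : c ≤ 1 := (min_le_left _ _).trans (min_le_right _ _)
  have hcm : c ≤ m / 12 := min_le_right _ _
  have hev : ∀ᶠ σ in nhds (0 : ℝ), σ < d ∧ L * σ < c₀ ∧ C * σ ^ 2 < m / 2 ∧ C * σ ^ 2 < 1 := by
    refine (eventually_lt_nhds hd0).and (Eventually.and ?_ (Eventually.and ?_ ?_))
    · exact (by fun_prop : Continuous fun σ : ℝ => L * σ).tendsto 0 |>.eventually_lt_const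
        (by simpa using hc₀)
    · exact (by fun_prop : Continuous fun σ : ℝ => C * σ ^ 2).tendsto 0 |>.eventually_lt_const
        (by simpa using hm0)
    · exact (by fun_prop : Continuous fun σ : ℝ => C * σ ^ 2).tendsto 0 |>.eventually_lt_const
        (by simp)
  obtain ⟨σ₀, hσ₀, hev⟩ := Metric.eventually_nhds_iff.1 hev
  refine ⟨c, C, M, δ, m, d, σ₀, hc0, hC0, hM0, hδ0, hδ2, hδm, hd0, hdd₁, hσ₀,
    fun s hs => hmin hs, hWd0, fun σ hσ hσσ => ?_⟩
  obtain ⟨hσd, hσL, hσm, hσ1⟩ := hev (y := σ) (by rwa [dist_zero_right, Real.norm_of_nonneg hσ.le])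
  refine ⟨hσd, hσm.le, ?_⟩
  set a := -1 + σ with ha
  have haI : a ∈ Icc (-1) (-1 + d) := ⟨by linarith, by linarith⟩
  have hsub : Icc a 1 ⊆ Icc (-1) 1 := Icc_subset_Icc_left haI.1
  have hWa : W a ≤ C₀ * σ ^ 2 := by simpa [ha] using hWu a haI
  have hWa0 : 0 ≤ W a := (hW.2.2.2.1 a ⟨by linarith, by linarith⟩).le
  set D := W a + σ ^ 2 + L * σ ^ 2 * (1 - a) with hD
  have hLσ : 0 ≤ L * σ ^ 2 := by positivity
  have hD0 : 0 ≤ D := by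
    have : 0 ≤ L * σ ^ 2 * (1 - a) := mul_nonneg hLσ (by linarith)
    positivity
  have hDle : D ≤ D₀ * σ ^ 2 := by
    have : L * σ ^ 2 * (1 - a) ≤ L * σ ^ 2 * 2 := mul_le_mul_of_nonneg_left (by linarith) hLσ
    rw [hD, hD₀]
    linarith
  have habs : ∀ s ∈ Icc a 1,
      |(W s - W a - L * σ ^ 2 * (s - a) + D * θ s) - W s| ≤ C * σ ^ 2 := by
    intro s hs
    have h1 : 0 ≤ L * σ ^ 2 * (s - a) := mul_nonneg hLσ (by linarith [hs.1])
    have h2 : L * σ ^ 2 * (s - a) ≤ L * σ ^ 2 * 2 :=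
      mul_le_mul_of_nonneg_left (by linarith [hs.2]) hLσ
    have h3 : 0 ≤ D * θ s := mul_nonneg hD0 (hθn s)
    have h4 : D * θ s ≤ D * 1 := mul_le_mul_of_nonneg_left (hθl s) hD0
    have h5 := mul_le_mul_of_nonneg_right hC1 (sq_nonneg σ)
    have h6 : 0 ≤ C₀ * σ ^ 2 := by positivity
    rw [abs_le]
    constructor <;> nlinarith
  have hsq : ∀ s ∈ Icc a 1, √(2 * (W s - W a - L * σ ^ 2 * (s - a) + D * θ s)) ≤ M := by
    intro s hs
    refine Real.sqrt_le_sqrt ?_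
    have h1 := (abs_le.1 (habs s hs)).2
    have h2 := (le_abs_self _).trans (hM₀ s (hsub hs))
    linarith
  have hdrift : ∀ s ∈ Icc a 1,
      Λ * σ ^ 2 * √(2 * (W s - W a - L * σ ^ 2 * (s - a) + D * θ s)) ≤ L * σ ^ 2 := by
    intro s hs
    have := mul_le_mul_of_nonneg_left (hsq s hs) (mul_nonneg hΛ (sq_nonneg σ))
    rw [hL]
    linarith
  refine ⟨fun s => W s - W a - L * σ ^ 2 * (s - a) + D * θ s,
    fun s => deriv W s - L * σ ^ 2 + D * θ' s, ?_, ?_, ?_, ?_, habs, hsq, ?_, ?_, ?_⟩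
  · have h1 : Continuous θ := continuous_iff_continuousAt.2 fun s => (hθ s).continuousAt
    have h2 := hW.continuousOn.mono hsub
    fun_prop
  · have h2 := hW.continuousOn_deriv.mono hsub
    fun_prop
  · intro s hs
    have h1 := hW.hasDerivAt (s := s) ⟨by linarith [hs.1], hs.2⟩
    exact (((h1.sub_const (W a)).sub (((hasDerivAt_id' s).sub_const a).const_mul (L * σ ^ 2))).add
      ((hθ s).const_mul D)).congr_deriv (by ring)
  · change W a - W a - L * σ ^ 2 * (a - a) + D * θ a = 0
    rw [hθ0 a (by linarith)]
    ring
  · intro s hs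
    have hx : 0 ≤ s - a := by linarith [hs.1]
    change c * ((s - a) * (s - a + σ)) ≤ W s - W a - L * σ ^ 2 * (s - a) + D * θ s ∨
      c * ((1 - s) ^ 2 + σ ^ 2) ≤ W s - W a - L * σ ^ 2 * (s - a) + D * θ s
    rcases le_total s (-1 + d) with h1 | h1
    · left
      have h2 := hWl a s haI.1 hs.1 h1
      rw [hθ0 s (by linarith)]
      have h3 : (s + 1) ^ 2 - (a + 1) ^ 2 = (s - a) * (s - a + σ) + (s - a) * σ := by
        rw [ha]; ring
      rw [h3] at h2
      have h4 : L * σ * ((s - a) * σ) ≤ c₀ * ((s - a) * σ) :=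
        mul_le_mul_of_nonneg_right hσL.le (by positivity)
      have h5 : c * ((s - a) * (s - a + σ)) ≤ c₀ * ((s - a) * (s - a + σ)) :=
        mul_le_mul_of_nonneg_right hcc (by positivity)
      linarith
    rcases le_total s (1 - d) with h2 | h2
    · left
      have h3 := hmin (show s ∈ Icc (-1 + d) (1 - d) from ⟨h1, h2⟩)
      have h4 := (abs_le.1 (habs s hs)).1
      have h5 : (s - a) * (s - a + σ) ≤ 2 * 3 :=
        mul_le_mul (by linarith) (by linarith) (by positivity) (by norm_num)
      have h6 : c * ((s - a) * (s - a + σ)) ≤ m / 12 * (2 * 3) :=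
        mul_le_mul hcm h5 (by positivity) (by positivity)
      change m ≤ W s at h3
      linarith
    · right
      have h3 := hWr s ⟨h2, hs.2⟩
      rw [hθ1 s (by linarith)]
      have h4 : c * (1 - s) ^ 2 ≤ c₀ * (1 - s) ^ 2 :=
        mul_le_mul_of_nonneg_right hcc (sq_nonneg _)
      have h5 : c * σ ^ 2 ≤ 1 * σ ^ 2 := mul_le_mul_of_nonneg_right hc1 (sq_nonneg _)
      have h6 : 0 ≤ L * σ ^ 2 * (1 - s) := mul_nonneg hLσ (by linarith [hs.2])
      rw [hD]
      linarith
  · intro s hs hsδ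
    have := hdrift s hs
    simp only [hθ'0 s hsδ]
    linarith
  · intro s hs
    have h1 := hdrift s hs
    have h2 : D * θ' s ≤ C * σ ^ 2 := by
      calc D * θ' s ≤ D * K := mul_le_mul_of_nonneg_left (hθ'K s) hD0
        _ ≤ D₀ * σ ^ 2 * K := mul_le_mul_of_nonneg_right hDle hK
        _ = D₀ * K * σ ^ 2 := by ring
        _ ≤ C * σ ^ 2 := mul_le_mul_of_nonneg_right hC2 (sq_nonneg σ)
    linarith

namespace IsBarrierPotential

variable {W H h : ℝ → ℝ} {c C M δ Λ σ : ℝ}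

theorem pos (hB : IsBarrierPotential W c C M δ Λ σ H h) (hc : 0 < c) (hσ : 0 < σ) {s : ℝ}
    (hs : s ∈ Ioc (-1 + σ) 1) : 0 < H s := by
  have hx : 0 < s - (-1 + σ) := sub_pos.2 hs.1
  rcases hB.lower_bound s (Ioc_subset_Icc_self hs) with h1 | h1
  · exact lt_of_lt_of_le (by positivity) h1
  · exact lt_of_lt_of_le (by positivity) h1

theorem exists_isProfile (hB : IsBarrierPotential W c C M δ Λ σ H h) (hc : 0 < c) (hσ : 0 < σ)
    (hσ1 : σ < 1) :
    ∃ T G : ℝ → ℝ, IsProfile H (-1 + σ) M T G ∧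
      T 1 - T (-1 + σ) ≤ √(1 / c) * (3 * Real.log 4 - 2 * Real.log σ) := by
  set a := -1 + σ with ha
  set K := √(1 / c) with hK
  have hK0 : 0 < K := Real.sqrt_pos.2 (by positivity)
  have hKc : K ^ 2 * c = 1 := by
    rw [hK, Real.sq_sqrt (by positivity)]
    field_simp
  have hσs : 0 < √σ := Real.sqrt_pos.2 hσ
  have hbound : ∀ s ∈ Ioo a 1, ∀ y > 0, c * y ^ 2 ≤ 2 * H s → (√(2 * H s))⁻¹ ≤ K * y⁻¹ := by
    intro s hs y hy hle
    have h1 : 0 < √(2 * H s) :=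
      Real.sqrt_pos.2 (mul_pos two_pos (hB.pos hc hσ (Ioo_subset_Ioc_self hs)))
    have h2 : y ≤ K * √(2 * H s) := by
      refine (sq_le_sq₀ hy.le (by positivity)).1 ?_
      rw [mul_pow, Real.sq_sqrt (Real.sqrt_pos.1 h1).le]
      calc y ^ 2 = K ^ 2 * (c * y ^ 2) := by rw [← mul_assoc, hKc, one_mul]
        _ ≤ _ := mul_le_mul_of_nonneg_left hle (sq_nonneg K)
    rw [← div_eq_mul_inv, inv_eq_one_div, div_le_div_iff₀ h1 hy]
    linarith
  have hF1 : ContinuousOn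
      (fun s => K * (2 * Real.log (√(s - a) + √σ) - Real.log (1 - s + σ))) (Icc a 1) := by
    refine continuousOn_const.mul (ContinuousOn.sub (continuousOn_const.mul ?_) ?_)
    · exact ContinuousOn.log (by fun_prop) fun s _ => (by positivity)
    · exact ContinuousOn.log (by fun_prop) fun s hs => by
        have := hs.2
        exact ne_of_gt (by linarith)
  have hF2 : ∀ s ∈ Ioo a 1, HasDerivAt
      (fun s => K * (2 * Real.log (√(s - a) + √σ) - Real.log (1 - s + σ)))
      (K * ((√(s - a) * (√(s - a) + √σ))⁻¹ + (1 - s + σ)⁻¹)) s := by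
    intro s hs
    have hx : 0 < s - a := sub_pos.2 hs.1
    have hxs : 0 < √(s - a) := Real.sqrt_pos.2 hx
    have hy : 0 < 1 - s + σ := by linarith [hs.2]
    have h1 := (((((hasDerivAt_id' s).sub_const a).sqrt hx.ne').add_const (√σ)).log
      (by positivity)).const_mul 2
    have h2 := (((hasDerivAt_id' s).const_sub 1).add_const σ).log hy.ne'
    refine ((h1.sub h2).const_mul K).congr_deriv ?_
    field_simp
    ring
  have hF3 : ∀ s ∈ Ioo a 1, (√(2 * H s))⁻¹ ≤
      K * ((√(s - a) * (√(s - a) + √σ))⁻¹ + (1 - s + σ)⁻¹) := by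
    intro s hs
    have hx : 0 < s - a := sub_pos.2 hs.1
    have hxs : 0 < √(s - a) := Real.sqrt_pos.2 hx
    have hy : 0 < 1 - s + σ := by linarith [hs.2]
    have hx2 := Real.sq_sqrt hx.le
    have hσ2 := Real.sq_sqrt hσ.le
    rw [mul_add]
    rcases hB.lower_bound s (Ioo_subset_Icc_self hs) with h1 | h1
    · refine (hbound s hs _ (by positivity) ?_).trans (le_add_of_nonneg_right (by positivity))
      refine le_trans ?_ (mul_le_mul_of_nonneg_left h1 two_pos.le)
      have h2 : (√(s - a) + √σ) ^ 2 ≤ 2 * (s - a + σ) := by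
        nlinarith [sq_nonneg (√(s - a) - √σ)]
      rw [mul_pow, hx2]
      have := mul_le_mul_of_nonneg_left h2 (mul_pos hc hx).le
      linarith
    · refine (hbound s hs _ (by positivity) ?_).trans (le_add_of_nonneg_left (by positivity))
      refine le_trans ?_ (mul_le_mul_of_nonneg_left h1 two_pos.le)
      have h2 : (1 - s + σ) ^ 2 ≤ 2 * ((1 - s) ^ 2 + σ ^ 2) := by
        nlinarith [sq_nonneg (1 - s - σ)]
      have := mul_le_mul_of_nonneg_left h2 hc.le
      linarith
  obtain ⟨T, G, hP, hle⟩ := _root_.exists_isProfile (by linarith : a < 0) hB.continuousOn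
    (fun s hs => hB.pos hc hσ (Ioo_subset_Ioc_self hs))
    (fun s hs => hB.sqrt_le s (Ioo_subset_Icc_self hs)) hF1 hF2 hF3
  refine ⟨T, G, hP, hle.trans ?_⟩
  rw [← mul_sub]
  refine mul_le_mul_of_nonneg_left ?_ hK0.le
  have h1 : Real.log (√σ) = Real.log σ / 2 := Real.log_sqrt hσ.le
  have h2 : Real.log (√(1 - a) + √σ) ≤ Real.log 4 := by
    refine Real.log_le_log (by positivity) ?_
    have : √(1 - a) ≤ 2 := by
      rw [Real.sqrt_le_left (by norm_num)]
      linarith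
    have : √σ ≤ 1 := Real.sqrt_le_one.2 hσ1.le
    linarith
  have h3 : Real.log (1 - a + σ) ≤ Real.log 4 := Real.log_le_log (by linarith) (by linarith)
  simp only [sub_self, Real.sqrt_zero, zero_add, h1]
  linarith

end IsBarrierPotential

theorem eq_zero_of_tendsto_deriv_sq {g : ℝ → ℝ} {l E : ℝ} (hg : Differentiable ℝ g)
    (hl : Tendsto g atTop (nhds l)) (hE : Tendsto (fun t => deriv g t ^ 2) atTop (nhds E)) :
    E = 0 := by
  have hex : ∀ n : ℕ, ∃ t ∈ Ioo (n : ℝ) (n + 1), deriv g t = g (n + 1) - g n := by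
    intro n
    obtain ⟨t, ht, h⟩ := exists_deriv_eq_slope g (lt_add_one (n : ℝ)) hg.continuous.continuousOn
      hg.differentiableOn
    exact ⟨t, ht, by simpa using h⟩
  choose t ht hgt using hex
  have ht_top : Tendsto t atTop atTop :=
    tendsto_atTop_mono (fun n => (ht n).1.le) tendsto_natCast_atTop_atTop
  have h1 := hE.comp ht_top
  have h2 : Tendsto (fun n : ℕ => (g (n + 1) - g n) ^ 2) atTop (nhds ((l - l) ^ 2)) := by
    refine (Tendsto.sub ?_ (hl.comp tendsto_natCast_atTop_atTop)).pow 2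
    exact hl.comp (tendsto_natCast_atTop_atTop.atTop_add tendsto_const_nhds)
  have h3 : (fun t => deriv g t ^ 2) ∘ t = fun n : ℕ => (g (n + 1) - g n) ^ 2 := by
    ext n
    simp [hgt]
  rw [h3] at h1
  simpa using tendsto_nhds_unique h1 h2

namespace IsOneDSolution

variable {W g : ℝ → ℝ}

theorem hasDerivAt (hg : IsOneDSolution W g) (t : ℝ) : HasDerivAt g (deriv g t) t :=
  (hg.1.differentiable two_ne_zero t).hasDerivAt

theorem deriv_sq_eq (hg : IsOneDSolution W g) (hW : DoubleWell W) (t : ℝ) :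
    deriv g t ^ 2 = 2 * W (g t) := by
  have hd : ∀ t, HasDerivAt (fun t => deriv g t ^ 2 - 2 * W (g t)) 0 t := by
    intro t
    have h1 : HasDerivAt (deriv g) (deriv W (g t)) t := by
      rw [← hg.2.2.1 t]
      exact (hg.1.differentiable_deriv_two t).hasDerivAt
    have h2 := (hW.hasDerivAt (hg.2.1 t)).comp t (hg.hasDerivAt t)
    refine ((h1.pow 2).sub (h2.const_mul 2)).congr_deriv ?_
    norm_num
    ring
  have hconst : ∀ s, deriv g s ^ 2 - 2 * W (g s) = deriv g t ^ 2 - 2 * W (g t) := fun s =>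
    is_const_of_deriv_eq_zero (fun t => (hd t).differentiableAt) (fun t => (hd t).deriv) s t
  have hWlim : Tendsto (fun s => W (g s)) atTop (nhds 0) := by
    have h1 : Tendsto W (nhdsWithin 1 (Icc (-1) 1)) (nhds (W 1)) :=
      hW.continuousOn 1 (by norm_num)
    rw [hW.2.2.1] at h1
    exact h1.comp (tendsto_nhdsWithin_iff.2 ⟨hg.2.2.2.2.2.1,
      Eventually.of_forall fun s => Ioo_subset_Icc_self (hg.2.1 s)⟩)
  have hlim : Tendsto (fun s => deriv g s ^ 2) atTop (nhds (deriv g t ^ 2 - 2 * W (g t))) := by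
    have h1 := (hWlim.const_mul 2).add_const (deriv g t ^ 2 - 2 * W (g t))
    rw [mul_zero, zero_add] at h1
    refine h1.congr fun s => ?_
    rw [← hconst s]
    ring
  have := eq_zero_of_tendsto_deriv_sq (hg.1.differentiable two_ne_zero) hg.2.2.2.2.2.1 hlim
  linarith

theorem deriv_eq_sqrt (hg : IsOneDSolution W g) (hW : DoubleWell W) (t : ℝ) :
    deriv g t = √(2 * W (g t)) := by
  rw [← hg.deriv_sq_eq hW, Real.sqrt_sq (hg.2.2.2.1 t).le]

end IsOneDSolution

theorem abs_sqrt_sub_sqrt_le {x y : ℝ} (hx : 0 ≤ x) (hy : 0 < y) :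
    |√x - √y| ≤ |x - y| / √y := by
  have hy' : 0 < √y := Real.sqrt_pos.2 hy
  rw [le_div_iff₀ hy']
  have h1 : |x - y| = |√x - √y| * (√x + √y) := by
    rw [← abs_of_nonneg (by positivity : 0 ≤ √x + √y), ← abs_mul]
    congr 1
    nlinarith [Real.sq_sqrt hx, Real.sq_sqrt hy.le]
  rw [h1]
  exact mul_le_mul_of_nonneg_left (le_add_of_nonneg_left (Real.sqrt_nonneg x)) (abs_nonneg _)

/-- If `|H - W| ≤ η` with `η` small compared to `W` along `g`, then the time function of `H`
almost inverts `g`. -/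
theorem IsProfile.abs_time_sub_le {W g H T G : ℝ → ℝ} {a M m η b : ℝ} (hW : DoubleWell W)
    (hg : IsOneDSolution W g) (hP : IsProfile H a M T G) (hm : 0 < m)
    (hη : η ≤ m / 2) (hmem : ∀ t ∈ Icc (-b) b, g t ∈ Ioo a 1) (hmW : ∀ t ∈ Icc (-b) b, m ≤ W (g t))
    (hHW : ∀ t ∈ Icc (-b) b, |H (g t) - W (g t)| ≤ η) {t : ℝ} (ht : t ∈ Icc (-b) b) :
    |T (g t) - t| ≤ 2 / m * η * |t| := by
  have h0 : (0 : ℝ) ∈ Icc (-b) b := by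
    have := ht.1.trans ht.2
    constructor <;> linarith
  have hd : ∀ s ∈ Icc (-b) b, HasDerivWithinAt (fun s => T (g s) - s)
      ((√(2 * H (g s)))⁻¹ * √(2 * W (g s)) - 1) (Icc (-b) b) s := by
    intro s hs
    have h1 := (hP.hasDerivAt_time _ (hmem s hs)).comp s (hg.hasDerivAt s)
    rw [hg.deriv_eq_sqrt hW] at h1
    exact (h1.sub (hasDerivAt_id' s)).hasDerivWithinAt
  have hb : ∀ s ∈ Icc (-b) b, ‖(√(2 * H (g s)))⁻¹ * √(2 * W (g s)) - 1‖ ≤ 2 / m * η := by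
    intro s hs
    have h1 := hmW s hs
    have h2 := hHW s hs
    have h3 : m / 2 ≤ H (g s) := by linarith [(abs_le.1 h2).1]
    have h4 : 0 < 2 * H (g s) := by linarith
    have h5 : 0 < √(2 * H (g s)) := Real.sqrt_pos.2 h4
    have h6 := abs_sqrt_sub_sqrt_le (by linarith : 0 ≤ 2 * W (g s)) h4
    have h7 : (√(2 * H (g s)))⁻¹ * √(2 * W (g s)) - 1 =
        (√(2 * W (g s)) - √(2 * H (g s))) / √(2 * H (g s)) := by
      field_simp
    rw [h7, Real.norm_eq_abs, abs_div, abs_of_pos h5]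
    calc |√(2 * W (g s)) - √(2 * H (g s))| / √(2 * H (g s))
        ≤ |2 * W (g s) - 2 * H (g s)| / √(2 * H (g s)) / √(2 * H (g s)) :=
          div_le_div_of_nonneg_right h6 h5.le
      _ = |H (g s) - W (g s)| / H (g s) := by
          rw [div_div, Real.mul_self_sqrt h4.le, ← mul_sub, abs_mul, abs_two, abs_sub_comm,
            mul_div_mul_left _ _ two_ne_zero]
      _ ≤ η / (m / 2) := div_le_div₀ ((abs_nonneg _).trans h2) h2 (by positivity) h3
      _ = 2 / m * η := by field_simp
  have := (convex_Icc (-b) b).norm_image_sub_le_of_norm_hasDerivWithin_le hd hb h0 ht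
  simpa [hg.2.2.2.2.1, hP.time_zero] using this

theorem IsProfile.abs_time_le_one {H T G : ℝ → ℝ} {a M δ : ℝ} (hP : IsProfile H a M T G)
    (hδ : 0 < δ) (hmem : ∀ s ∈ Icc (-δ) δ, s ∈ Ioo a 1)
    (hH : ∀ s ∈ Icc (-δ) δ, δ ^ 2 ≤ 2 * H s) {s : ℝ} (hs : s ∈ Icc (-δ) δ) : |T s| ≤ 1 := by
  have h := (convex_Icc (-δ) δ).norm_image_sub_le_of_norm_hasDerivWithin_le (C := δ⁻¹)
    (fun s hs => (hP.hasDerivAt_time s (hmem s hs)).hasDerivWithinAt)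
    (fun s hs => by
      rw [norm_inv, Real.norm_of_nonneg (Real.sqrt_nonneg _)]
      exact inv_anti₀ hδ (Real.le_sqrt_of_sq_le (hH s hs)))
    (show (0 : ℝ) ∈ Icc (-δ) δ by constructor <;> linarith) hs
  rw [hP.time_zero, sub_zero, sub_zero, Real.norm_eq_abs, Real.norm_eq_abs] at h
  refine h.trans ?_
  rw [inv_mul_le_one₀ hδ]
  exact abs_le.2 hs

theorem deriv_eq_zero_of_eventually_const {G : ℝ → ℝ} {t y : ℝ} (h : ∀ᶠ s in nhds t, G s = y) :
    deriv G t = 0 ∧ deriv (deriv G) t = 0 := by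
  have h0 : ∀ᶠ s in nhds t, deriv G s = 0 := by
    filter_upwards [h.eventually_nhds] with s hs
    have : G =ᶠ[nhds s] fun _ => y := hs
    rw [this.deriv_eq, deriv_const]
  refine ⟨h0.self_of_nhds, ?_⟩
  have : deriv G =ᶠ[nhds t] fun _ => 0 := h0
  rw [this.deriv_eq, deriv_const]

theorem DoubleWell.exists_abs_sub_le {W : ℝ → ℝ} (hW : DoubleWell W) :
    ∃ B, 0 ≤ B ∧ ∀ x ∈ Ioo (-1 : ℝ) 1, ∀ y ∈ Ioo (-1 : ℝ) 1, |W x - W y| ≤ B * |x - y| := by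
  obtain ⟨B, hB⟩ := (isCompact_Icc (a := (-1 : ℝ)) (b := 1)).exists_bound_of_continuousOn
    hW.continuousOn_deriv
  refine ⟨B, (norm_nonneg _).trans (hB 0 (by norm_num)), fun x hx y hy => ?_⟩
  exact (convex_Ioo (-1 : ℝ) 1).norm_image_sub_le_of_norm_hasDerivWithin_le
    (fun s hs => (hW.hasDerivAt hs).hasDerivWithinAt)
    (fun s hs => hB s (Ioo_subset_Icc_self hs)) hy hx

/-- Lemma 5.1: construction of a one-dimensional barrier `g_R` approximating
the 1D solution `g`, strictly increasing and `C²` on `[t_R⁻, t_R⁺]` with `|t_R^±| ≤ C log R`,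
constant outside (equal to `1` on the right), with `g_R(0)=0`, `g_R'(t_R⁻)=0`,
`|g-g_R|, |g'-g_R'| ≤ C/R` on `[-4,4]`, and satisfying
`g_R'' + (2(n-1)/R) g_R' ≤ W'(g_R) + (C/R)χ_{[-1,1]}` pointwise away from `t_R^±` and in the
viscosity sense at `t_R^±`. -/
theorem oneD_radial_barrier
    (n : ℕ) (hn : 1 ≤ n) (W : ℝ → ℝ) (hW : DoubleWell W)
    (g : ℝ → ℝ) (hg : IsOneDSolution W g) :
    ∃ C : ℝ, 0 < C ∧ ∃ R₀ : ℝ, ∀ R : ℝ, R₀ ≤ R →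
      ∃ (gR : ℝ → ℝ) (tm tp : ℝ),
        tm < 0 ∧ 0 < tp ∧ |tm| ≤ C * Real.log R ∧ |tp| ≤ C * Real.log R ∧
        (∀ t, gR t ∈ Set.Icc (-1:ℝ) 1) ∧
        ContDiffOn ℝ 2 gR (Set.Icc tm tp) ∧
        StrictMonoOn gR (Set.Icc tm tp) ∧
        (∀ t ≤ tm, gR t = gR tm) ∧
        (∀ t, tp ≤ t → gR t = 1) ∧
        gR 0 = 0 ∧ deriv gR tm = 0 ∧
        (∀ t ∈ Set.Icc (-4:ℝ) 4, |g t - gR t| ≤ C / R ∧ |deriv g t - deriv gR t| ≤ C / R) ∧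
        (∀ t : ℝ, t ≠ tm → t ≠ tp →
          deriv (deriv gR) t + (2 * ((n:ℝ) - 1) / R) * deriv gR t ≤
            deriv W (gR t) + (C / R) * Set.indicator (Set.Icc (-1:ℝ) 1) (fun _ => (1:ℝ)) t) ∧
        (∀ t : ℝ, (t = tm ∨ t = tp) →
          ∀ ψ : ℝ → ℝ, ContDiff ℝ 2 ψ → ψ t = gR t → (∀ s, ψ s ≤ gR s) →
            deriv (deriv ψ) t + (2 * ((n:ℝ) - 1) / R) * deriv ψ t ≤
              deriv W (gR t) + (C / R) * Set.indicator (Set.Icc (-1:ℝ) 1) (fun _ => (1:ℝ)) t) := by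
  set Λ : ℝ := 2 * ((n : ℝ) - 1) with hΛ
  have hΛ0 : 0 ≤ Λ := by
    have : (1 : ℝ) ≤ n := by exact_mod_cast hn
    rw [hΛ]
    linarith
  have hgmono : StrictMono g := strictMono_of_deriv_pos hg.2.2.2.1
  set d₁ := min (1 / 2) (min (1 + g (-5)) (1 - g 5)) with hd₁
  have hd₁0 : 0 < d₁ := lt_min (by norm_num)
    (lt_min (by linarith [(hg.2.1 (-5)).1]) (by linarith [(hg.2.1 5).2]))
  have hd₁h : d₁ ≤ 1 / 2 := min_le_left _ _
  have hd₁l : d₁ ≤ 1 + g (-5) := (min_le_right _ _).trans (min_le_left _ _)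
  have hd₁r : d₁ ≤ 1 - g 5 := (min_le_right _ _).trans (min_le_right _ _)
  obtain ⟨c, C₁, M, δ, m, d, σ₀, hc, hC₁, hM, hδ, hδ2, hδm, hd, hdd₁, hσ₀, hmW, hWd, hex⟩ :=
    hW.exists_isBarrierPotential hΛ0 hd₁0 hd₁h
  obtain ⟨B, hB0, hB⟩ := hW.exists_abs_sub_le
  have hm : 0 < m := lt_of_lt_of_le (by positivity) hδm
  set K := √(1 / c) with hK
  have hK0 : 0 ≤ K := Real.sqrt_nonneg _
  set C₂ := 2 / m * C₁ * 5 with hC₂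
  have hC₂0 : 0 < C₂ := by positivity
  set C₃ := 2 * (B * (M * C₂) + C₁) / √(2 * m) with hC₃
  have hC₃0 : 0 ≤ C₃ := by positivity
  set C := C₁ + M * C₂ + C₃ + 4 * K with hC
  have hMC₂ : 0 < M * C₂ := by positivity
  have hCC₁ : C₁ ≤ C := by linarith
  have hCC₂ : M * C₂ ≤ C := by linarith
  have hCC₃ : C₃ ≤ C := by linarith
  have hCK : 4 * K ≤ C := by linarith
  have hC0 : 0 < C := by linarith
  refine ⟨C, hC0, max 4 (max ((σ₀ ^ 2)⁻¹ + 1) (C₂ + 1)), fun R hR => ?_⟩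
  have hR4 : 4 ≤ R := (le_max_left _ _).trans hR
  have hRσ : (σ₀ ^ 2)⁻¹ < R := by
    linarith [(le_max_left ((σ₀ ^ 2)⁻¹ + 1) (C₂ + 1)).trans ((le_max_right _ _).trans hR)]
  have hRC : C₂ < R := by
    linarith [(le_max_right ((σ₀ ^ 2)⁻¹ + 1) (C₂ + 1)).trans ((le_max_right _ _).trans hR)]
  have hR0 : 0 < R := by linarith
  set σ := √(R⁻¹) with hσdef
  have hσ : 0 < σ := Real.sqrt_pos.2 (inv_pos.2 hR0)
  have hσ2 : σ ^ 2 = R⁻¹ := Real.sq_sqrt (inv_pos.2 hR0).le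
  have hσσ₀ : σ < σ₀ := by
    rw [← sq_lt_sq₀ hσ.le hσ₀.le, hσ2]
    exact inv_lt_of_inv_lt₀ (by positivity) hRσ
  obtain ⟨hσd, hσm, H, h, hH⟩ := hex σ hσ hσσ₀
  have hσ1 : σ < 1 := by linarith
  obtain ⟨T, G, hP, hTT⟩ := hH.exists_isProfile hc hσ hσ1
  set a := -1 + σ with ha
  have ha0 : a < 0 := by linarith
  have hpos : ∀ s ∈ Ioc a 1, 0 < H s := fun s hs => hH.pos hc hσ hs
  have hpos' : ∀ s ∈ Ioo a 1, 0 < H s := fun s hs => hpos s (Ioo_subset_Ioc_self hs)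
  have hTa := hP.time_left_lt ha0
  have hT1 := hP.time_right_gt ha0
  have hlogR : T 1 - T a ≤ C * Real.log R := by
    have h1 : Real.log σ = - Real.log R / 2 := by
      rw [hσdef, Real.log_sqrt (inv_pos.2 hR0).le, Real.log_inv]
    have h2 : Real.log 4 ≤ Real.log R := Real.log_le_log (by norm_num) hR4
    have h3 : 0 ≤ Real.log R := Real.log_nonneg (by linarith)
    refine hTT.trans (le_trans (mul_le_mul_of_nonneg_left
      (show _ ≤ 4 * Real.log R by rw [h1]; linarith) hK0) ?_)
    have := mul_le_mul_of_nonneg_right hCK h3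
    linarith
  have hgI : ∀ t ∈ Icc (-5 : ℝ) 5, g t ∈ Icc (-1 + d) (1 - d) := fun t ht =>
    ⟨by linarith [hgmono.monotone ht.1], by linarith [hgmono.monotone ht.2]⟩
  have hI : ∀ s ∈ Icc (-1 + d) (1 - d), s ∈ Ioo a 1 := fun s hs =>
    ⟨by linarith [hs.1], by linarith [hs.2]⟩
  have htime : ∀ t ∈ Icc (-5 : ℝ) 5, |T (g t) - t| ≤ C₂ / R := by
    intro t ht
    have h1 := hP.abs_time_sub_le hW hg hm hσm (fun t ht => hI _ (hgI t ht))
      (fun t ht => hmW _ (hgI t ht))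
      (fun t ht => hH.abs_sub_le _ (Ioo_subset_Icc_self (hI _ (hgI t ht)))) ht
    refine h1.trans ?_
    rw [hσ2]
    have := mul_le_mul_of_nonneg_left (abs_le.2 ht)
      (by positivity : 0 ≤ 2 / m * (C₁ * R⁻¹))
    refine this.trans (le_of_eq ?_)
    rw [hC₂]
    ring
  have hC₂R : C₂ / R < 1 := (div_lt_one hR0).2 hRC
  have hIoo : ∀ t ∈ Icc (-4 : ℝ) 4, t ∈ Ioo (T a) (T 1) := by
    intro t ht
    have h5 : (5 : ℝ) ∈ Icc (-5 : ℝ) 5 := by norm_num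
    have h5' : (-5 : ℝ) ∈ Icc (-5 : ℝ) 5 := by norm_num
    have h1 := hI _ (hgI 5 h5)
    have h2 := hI _ (hgI (-5) h5')
    have h3 := hP.strictMonoOn_time (Ioo_subset_Icc_self h1) ⟨by linarith, le_rfl⟩ h1.2
    have h4 := hP.strictMonoOn_time ⟨le_rfl, by linarith⟩ (Ioo_subset_Icc_self h2) h2.1
    have h6 := (abs_le.1 (htime 5 h5)).1
    have h7 := (abs_le.1 (htime (-5) h5')).2
    exact ⟨by linarith [ht.1], by linarith [ht.2]⟩
  have hclose : ∀ t ∈ Icc (-4 : ℝ) 4, |g t - G t| ≤ M * C₂ / R := by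
    intro t ht
    have ht5 : t ∈ Icc (-5 : ℝ) 5 := ⟨by linarith [ht.1], by linarith [ht.2]⟩
    have h1 := hP.lipschitz (T (g t)) t
    rw [hP.apply_time _ (Ioo_subset_Icc_self (hI _ (hgI t ht5)))] at h1
    refine h1.trans ?_
    rw [mul_div_assoc]
    exact mul_le_mul_of_nonneg_left (htime t ht5) hM.le
  have hlayer : ∀ t ∈ Ioo (T a) (T 1), G t ∈ Icc (-δ) δ → t ∈ Icc (-1 : ℝ) 1 := by
    intro t ht hGt
    have hsub : ∀ s ∈ Icc (-δ) δ, s ∈ Icc (-1 + d) (1 - d) := fun s hs =>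
      ⟨by linarith [hs.1], by linarith [hs.2]⟩
    have h1 := hP.abs_time_le_one hδ (fun s hs => hI s (hsub s hs)) (fun s hs => by
      have h1 := hmW s (hsub s hs)
      have h2 := (abs_le.1 (hH.abs_sub_le s (Ioo_subset_Icc_self (hI s (hsub s hs))))).1
      linarith) hGt
    rw [hP.time_apply t (Ioo_subset_Icc_self ht)] at h1
    exact abs_le.1 h1
  have hWa : 0 ≤ deriv W a := hWd a ⟨by linarith, by linarith⟩
  have hind : ∀ t : ℝ, 0 ≤ C / R * indicator (Icc (-1 : ℝ) 1) (fun _ => (1 : ℝ)) t := fun t =>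
    mul_nonneg (by positivity) (indicator_nonneg (fun _ _ => zero_le_one) t)
  refine ⟨G, T a, T 1, hTa, hT1, ?_, ?_, ?_, ?_, hP.strictMonoOn, ?_, hP.apply_of_ge, ?_, ?_,
    ?_, ?_, ?_⟩
  · rw [abs_of_neg hTa]
    linarith
  · rw [abs_of_pos hT1]
    linarith
  · exact fun t => ⟨by linarith [(hP.mem t).1], (hP.mem t).2⟩
  · exact hP.contDiffOn ha0 hH.continuousOn hpos' hH.continuousOn_deriv hH.hasDerivAt
  · intro t ht
    rw [hP.apply_of_le t ht, hP.apply_of_le _ le_rfl]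
  · have := hP.apply_time 0 ⟨ha0.le, zero_le_one⟩
    rwa [hP.time_zero] at this
  · exact (hP.hasDerivAt_left ha0 hH.continuousOn hpos' hH.apply_left).deriv
  · intro t ht
    refine ⟨(hclose t ht).trans (div_le_div_of_nonneg_right hCC₂ hR0.le), ?_⟩
    have hGt := hP.apply_mem_Ioo (hIoo t ht)
    have hgt : m ≤ W (g t) := hmW _ (hgI t ⟨by linarith [ht.1], by linarith [ht.2]⟩)
    rw [hg.deriv_eq_sqrt hW, (hP.hasDerivAt hpos' (hIoo t ht)).deriv, abs_sub_comm]
    have h1 : |2 * H (G t) - 2 * W (g t)| ≤ 2 * (B * (M * C₂) + C₁) / R := by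
      have h2 := hB (G t) ⟨by linarith [hGt.1], hGt.2⟩ (g t) (hg.2.1 t)
      have h3 := mul_le_mul_of_nonneg_left (hclose t ht) hB0
      rw [abs_sub_comm (g t)] at h3
      have h4 := hH.abs_sub_le _ (Ioo_subset_Icc_self hGt)
      rw [hσ2] at h4
      have h5 := abs_sub_le (H (G t)) (W (G t)) (W (g t))
      rw [← mul_sub, abs_mul, abs_two, mul_div_assoc]
      have h6 : (B * (M * C₂) + C₁) / R = B * (M * C₂ / R) + C₁ * R⁻¹ := by
        field_simp
      rw [h6]
      linarith
    calc |√(2 * H (G t)) - √(2 * W (g t))|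
        ≤ |2 * H (G t) - 2 * W (g t)| / √(2 * W (g t)) :=
          abs_sqrt_sub_sqrt_le (mul_pos two_pos (hpos' _ hGt)).le (by linarith)
      _ ≤ 2 * (B * (M * C₂) + C₁) / R / √(2 * m) :=
          div_le_div₀ (by positivity) h1 (by positivity) (Real.sqrt_le_sqrt (by linarith))
      _ = C₃ / R := by rw [hC₃, div_right_comm]
      _ ≤ C / R := div_le_div_of_nonneg_right hCC₃ hR0.le
  · intro t hta ht1
    rcases lt_or_gt_of_ne hta with h1 | h1
    · have h2 := deriv_eq_zero_of_eventually_const (y := a) (by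
        filter_upwards [Iio_mem_nhds h1] with s hs using hP.apply_of_le s (le_of_lt hs))
      rw [h2.1, h2.2, hP.apply_of_le t h1.le]
      linarith [hind t]
    rcases lt_or_gt_of_ne ht1 with h3 | h3
    · have hGt := Ioo_subset_Icc_self (hP.apply_mem_Ioo ⟨h1, h3⟩)
      rw [(hP.hasDerivAt hpos' ⟨h1, h3⟩).deriv, hP.deriv_deriv hpos' hH.hasDerivAt ⟨h1, h3⟩,
        div_eq_mul_inv, ← hσ2]
      by_cases ht : t ∈ Icc (-1 : ℝ) 1
      · rw [indicator_of_mem ht, mul_one, div_eq_mul_inv, ← hσ2]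
        have := hH.drift_le _ hGt
        have := mul_le_mul_of_nonneg_right hCC₁ (sq_nonneg σ)
        linarith
      · have := hH.drift_le_of_notMem _ hGt fun h => ht (hlayer t ⟨h1, h3⟩ h)
        linarith [hind t]
    · have h2 := deriv_eq_zero_of_eventually_const (y := 1) (by
        filter_upwards [Ioi_mem_nhds h3] with s hs using hP.apply_of_ge s (le_of_lt hs))
      rw [h2.1, h2.2, hP.apply_of_ge t h3.le, hW.2.2.2.2.2.1]
      linarith [hind t]
  · rintro t (rfl | rfl) ψ hψ heq hle
    · obtain ⟨h1, h2⟩ := hP.viscosity_left ha0 hH.continuousOn hpos' hH.apply_left hψ heq hle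
      rw [h1, hP.apply_of_le _ le_rfl]
      linarith [hind (T a)]
    · exact absurd hle (hP.not_touching_right ha0 hH.continuousOn hpos'
        (hpos 1 ⟨by linarith, le_rfl⟩) hψ heq)

end
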